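/- For t = n (and b_1=⋯=b_n arbitrary but with the square-free monomial ideal generated by all square-free monomials of degree t in n variables, i.e., m = n, all b_i = 1 giving the ideal of all square-free degree-t monomials), the q-th Betti number of the ideal generated by all square-free monomials of degree t in k[z_1,…,z_n] equals binom(t+q−1, t−1)·binom(n, t+q). -/

import Mathlib

/-- A minimal free resolution of an `S`-module `M` over a local-like pair `(S, 𝔪)`
(for us `S` is a polynomial ring and `𝔪` its irrelevant maximal ideal), recorded together
with its Betti numbers `β q`: an exact complex
`⋯ → S^{β(q+1)} → S^{β q} → ⋯ → S^{β 0} → M → 0`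
all of whose differentials have image inside `𝔪` times the target. -/
structure MinimalFreeResolution (S : Type*) [CommRing S] (𝔪 : Ideal S)
    (M : Type*) [AddCommGroup M] [Module S M] where
  /-- the Betti numbers, i.e. the ranks of the free modules in the resolution -/
  β : ℕ → ℕ
  /-- the differentials of the resolution -/
  d : ∀ q : ℕ, ((Fin (β (q + 1)) →₀ S) →ₗ[S] (Fin (β q) →₀ S))
  /-- the augmentation map onto `M` -/
  ε : (Fin (β 0) →₀ S) →ₗ[S] M
  surj : Function.Surjective ε
  exact_zero : LinearMap.ker ε = LinearMap.range (d 0)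
  exact : ∀ q, LinearMap.ker (d q) = LinearMap.range (d (q + 1))
  minimal : ∀ q, LinearMap.range (d q) ≤ 𝔪 • (⊤ : Submodule S (Fin (β q) →₀ S))

namespace SqVer
open MvPolynomial Matrix

theorem lift_range {S A B C : Type*} [CommRing S] [AddCommGroup A] [AddCommGroup B] [AddCommGroup C]
    [Module S A] [Module S B] [Module S C] [Module.Projective S A] (u : A →ₗ[S] C) (v : B →ₗ[S] C)
    (huv : ∀ x, u x ∈ LinearMap.range v) : ∃ w : A →ₗ[S] B, ∀ x, v (w x) = u x := by
  obtain ⟨w, hw⟩ := Module.projective_lifting_property v.rangeRestrict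
    (u.codRestrict (LinearMap.range v) huv) v.surjective_rangeRestrict
  refine ⟨w, fun x => ?_⟩
  have := congrArg Subtype.val (LinearMap.congr_fun hw x)
  simpa using this

/-- Comparison of two resolutions by projectives, with the homotopy recorded one step at a time. -/
theorem compare {S : Type*} [CommRing S] {𝔪 : Ideal S} {M : Type*} [AddCommGroup M] [Module S M]
    (F : ℕ → Type*) [∀ q, AddCommGroup (F q)] [∀ q, Module S (F q)] [∀ q, Module.Projective S (F q)]
    (G : ℕ → Type*) [∀ q, AddCommGroup (G q)] [∀ q, Module S (G q)] [∀ q, Module.Projective S (G q)]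
    (d : ∀ q, F (q + 1) →ₗ[S] F q) (d' : ∀ q, G (q + 1) →ₗ[S] G q)
    (ε : F 0 →ₗ[S] M) (ε' : G 0 →ₗ[S] M)
    (hε : Function.Surjective ε) (hε' : Function.Surjective ε')
    (h0 : LinearMap.ker ε = LinearMap.range (d 0)) (h0' : LinearMap.ker ε' = LinearMap.range (d' 0))
    (h1 : ∀ q, LinearMap.ker (d q) = LinearMap.range (d (q + 1)))
    (h1' : ∀ q, LinearMap.ker (d' q) = LinearMap.range (d' (q + 1)))
    (hm : ∀ q, LinearMap.range (d q) ≤ 𝔪 • (⊤ : Submodule S (F q))) (q : ℕ) :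
    ∃ (f : F q →ₗ[S] G q) (g : G q →ₗ[S] F q) (h : F q →ₗ[S] F (q + 1)),
      (∀ x, f (d q x) ∈ LinearMap.range (d' q)) ∧
      (∀ x, g (d' q x) ∈ LinearMap.range (d q)) ∧
      (∀ x, g (f (d q x)) - d q x = d q (h (d q x))) ∧
      (∀ x, g (f x) - x ∈ 𝔪 • (⊤ : Submodule S (F q))) := by
  induction q with
  | zero =>
    obtain ⟨f, hf⟩ := Module.projective_lifting_property ε' ε hε'
    obtain ⟨g, hg⟩ := Module.projective_lifting_property ε ε' hε
    replace hf : ∀ x, ε' (f x) = ε x := fun x => LinearMap.congr_fun hf x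
    replace hg : ∀ x, ε (g x) = ε' x := fun x => LinearMap.congr_fun hg x
    have z : ∀ x, ε (d 0 x) = 0 := fun x => by
      rw [← LinearMap.mem_ker, h0]; exact ⟨x, rfl⟩
    have z' : ∀ x, ε' (d' 0 x) = 0 := fun x => by
      rw [← LinearMap.mem_ker, h0']; exact ⟨x, rfl⟩
    obtain ⟨h, hh⟩ := lift_range (g ∘ₗ f - LinearMap.id) (d 0) (fun x => by
          rw [← h0, LinearMap.mem_ker]; simp [hf, hg])
    refine ⟨f, g, h, fun x => ?_, fun x => ?_, fun x => ?_, fun x => ?_⟩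
    · rw [← h0', LinearMap.mem_ker, hf, z]
    · rw [← h0, LinearMap.mem_ker, hg, z']
    · rw [hh]; simp
    · have := hh x
      simp at this
      rw [← this]
      exact hm 0 ⟨_, rfl⟩
  | succ q ih =>
    obtain ⟨f, g, h, hf, hg, hh, -⟩ := ih
    have z : ∀ x, d q (d (q+1) x) = 0 := fun x => by
      rw [← LinearMap.mem_ker, h1]; exact ⟨x, rfl⟩
    have z' : ∀ x, d' q (d' (q+1) x) = 0 := fun x => by
      rw [← LinearMap.mem_ker, h1']; exact ⟨x, rfl⟩
    obtain ⟨f1, hf1⟩ := lift_range (f ∘ₗ d q) (d' q) hf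
    replace hf1 : ∀ x, d' q (f1 x) = f (d q x) := hf1
    obtain ⟨g1, hg1⟩ := lift_range (g ∘ₗ d' q) (d q) hg
    replace hg1 : ∀ x, d q (g1 x) = g (d' q x) := hg1
    obtain ⟨h', hh'⟩ := lift_range (g1 ∘ₗ f1 - LinearMap.id - h ∘ₗ d q) (d (q+1)) (fun x => by
          rw [← h1, LinearMap.mem_ker]; simp [hf1, hg1, ← hh])
    refine ⟨f1, g1, h', fun x => ?_, fun x => ?_, fun x => ?_, fun x => ?_⟩
    · rw [← h1', LinearMap.mem_ker, hf1, z, map_zero]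
    · rw [← h1, LinearMap.mem_ker, hg1, z', map_zero]
    · rw [hh']; simp [z]
    · have := hh' x
      simp at this
      have e : g1 (f1 x) - x = d (q+1) (h' x) + h (d q x) := by rw [this]; abel
      rw [e]
      refine Submodule.add_mem _ (hm _ ⟨_, rfl⟩) ?_
      have h2 : d q x ∈ 𝔪 • (⊤ : Submodule S (F q)) := hm q ⟨_, rfl⟩
      have h3 := Submodule.mem_map_of_mem (f := h) h2
      rw [Submodule.map_smul''] at h3
      exact Submodule.smul_mono le_rfl le_top h3

theorem card_le {S K : Type*} [CommRing S] [Field K] (π : S →+* K) {𝔪 : Ideal S}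
    (hπ : ∀ x ∈ 𝔪, π x = 0) {ι κ : Type*} [Fintype ι] [Fintype κ] [DecidableEq ι] [DecidableEq κ]
    {A B : Type*} [AddCommGroup A] [Module S A] [AddCommGroup B] [Module S B]
    (bA : Module.Basis ι S A) (bB : Module.Basis κ S B)
    (f : A →ₗ[S] B) (g : B →ₗ[S] A)
    (h : ∀ x, g (f x) - x ∈ 𝔪 • (⊤ : Submodule S A)) : Fintype.card ι ≤ Fintype.card κ := by
  have hco : ∀ x ∈ 𝔪 • (⊤ : Submodule S A), ∀ i, π (bA.repr x i) = 0 := by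
    intro x hx i
    induction hx using Submodule.smul_induction_on' with
    | smul r hr y hy => simp [hπ r hr]
    | add x hx y hy h1 h2 => simp [h1, h2]
  have h1 : (LinearMap.toMatrix bB bA g).map π * (LinearMap.toMatrix bA bB f).map π = 1 := by
    rw [← Matrix.map_mul, ← LinearMap.toMatrix_comp]
    ext i j
    have := hco _ (h (bA j)) i
    rw [map_sub, Finsupp.sub_apply, map_sub, sub_eq_zero] at this
    simp only [Matrix.map_apply, LinearMap.toMatrix_apply, LinearMap.comp_apply]
    rw [this]
    simp [Matrix.one_apply, Finsupp.single_apply, eq_comm]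
  calc Fintype.card ι = (1 : Matrix ι ι K).rank := by rw [Matrix.rank_one]
    _ ≤ ((LinearMap.toMatrix bA bB f).map π).rank := by rw [← h1]; exact Matrix.rank_mul_le_right _ _
    _ ≤ _ := Matrix.rank_le_card_height _

/-- Linear resolution of an ideal (given by a membership predicate) generated in degree `t`. -/
structure LinRes (k : Type*) [Field k] (n : ℕ) (P : MvPolynomial (Fin n) k → Prop) (t : ℕ) where
  ι : ℕ → Type
  fin : ∀ q, Fintype (ι q)
  dec : ∀ q, DecidableEq (ι q)
  D : ∀ q, Matrix (ι q) (ι (q + 1)) (MvPolynomial (Fin n) k)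
  e : ι 0 → MvPolynomial (Fin n) k
  e_hom : ∀ i, (e i).IsHomogeneous t
  D_hom : ∀ q i j, (D q i j).IsHomogeneous 1
  mem : ∀ p, P p ↔ ∃ v, p = e ⬝ᵥ v
  exact0 : ∀ v, e ⬝ᵥ v = 0 ↔ ∃ w, v = D 0 *ᵥ w
  exact : ∀ q v, D q *ᵥ v = 0 ↔ ∃ w, v = D (q + 1) *ᵥ w

attribute [instance] LinRes.fin LinRes.dec

/-- membership predicate of the ideal of squarefree monomials of degree `t` in the
first `m` variables -/
def P {k : Type*} [Field k] {n : ℕ} (m t : ℕ) (p : MvPolynomial (Fin n) k) : Prop :=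
  ∀ s ∈ p.support, t ≤ (s.support.filter (fun i : Fin n => (i : ℕ) < m)).card

theorem hc_mul {k : Type*} [Field k] {n : ℕ} (a v : MvPolynomial (Fin n) k)
    (r m : ℕ) (ha : a.IsHomogeneous r) :
    homogeneousComponent (r + m) (a * v) = a * homogeneousComponent m v := by
  have key : ∀ i, homogeneousComponent (r + m) (a * homogeneousComponent i v)
      = a * homogeneousComponent m (homogeneousComponent i v) := by
    intro i
    rw [homogeneousComponent_of_mem (n := r + i) (ha.mul (homogeneousComponent_isHomogeneous i v)),
      homogeneousComponent_of_mem (n := i) (homogeneousComponent_isHomogeneous i v)]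
    simp
  conv_lhs => rw [← sum_homogeneousComponent v]
  conv_rhs => rw [← sum_homogeneousComponent v]
  rw [Finset.mul_sum, map_sum, map_sum, Finset.mul_sum]
  exact Finset.sum_congr rfl fun i _ => key i

theorem hc_dot {k : Type*} [Field k] {n : ℕ} {ι : Type} [Fintype ι] (a v : ι → MvPolynomial (Fin n) k)
    (r m : ℕ) (ha : ∀ i, (a i).IsHomogeneous r) :
    homogeneousComponent (r + m) (a ⬝ᵥ v) = a ⬝ᵥ (fun i => homogeneousComponent m (v i)) := by
  simp only [dotProduct, map_sum]
  exact Finset.sum_congr rfl fun i _ => hc_mul _ _ _ _ (ha i)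

variable {k : Type*} [Field k] {n : ℕ}

/-- Splitting off the variable number `m`. -/
theorem P_succ {m : ℕ} (hm : m < n) (t : ℕ) (p : MvPolynomial (Fin n) k) :
    P (m + 1) (t + 1) p ↔ ∃ p1 p2, P m (t + 1) p1 ∧ P m t p2 ∧ p = p1 + X ⟨m, hm⟩ * p2 := by
  have hcard : ∀ s : Fin n →₀ ℕ, (s.support.filter (fun i : Fin n => (i : ℕ) < m + 1)).card =
      (s.support.filter (fun i : Fin n => (i : ℕ) < m)).card + if s ⟨m, hm⟩ = 0 then 0 else 1 := by
    intro s
    have : s.support.filter (fun i : Fin n => (i : ℕ) < m + 1) =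
      s.support.filter (fun i : Fin n => (i : ℕ) < m) ∪
        s.support.filter (fun i : Fin n => i = ⟨m, hm⟩) := by
      ext i
      simp only [Finset.mem_filter, Finset.mem_union, Fin.ext_iff]
      constructor
      · rintro ⟨h1, h2⟩
        rcases Nat.lt_succ_iff_lt_or_eq.1 h2 with h | h
        · exact Or.inl ⟨h1, h⟩
        · exact Or.inr ⟨h1, h⟩
      · rintro (⟨h1, h2⟩ | ⟨h1, h2⟩) <;> exact ⟨h1, by omega⟩
    rw [this, Finset.card_union_of_disjoint]
    · congr 1
      rw [Finset.filter_eq']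
      split_ifs <;> simp_all
    · rw [Finset.disjoint_filter]
      rintro i _ h1 rfl
      simp at h1
  have hsame : ∀ s : Fin n →₀ ℕ, ((Finsupp.single (⟨m, hm⟩ : Fin n) 1 + s).support.filter
      (fun i : Fin n => (i : ℕ) < m)) = (s.support.filter (fun i : Fin n => (i : ℕ) < m)) := by
    intro s
    ext i
    simp only [Finset.mem_filter, Finsupp.mem_support_iff, Finsupp.add_apply]
    refine and_congr_left fun h => ?_
    rw [Finsupp.single_eq_of_ne (by rintro rfl; simp at h), zero_add]
  constructor
  · intro hp
    refine ⟨p.modMonomial (Finsupp.single ⟨m, hm⟩ 1), p.divMonomial (Finsupp.single ⟨m, hm⟩ 1),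
      ?_, ?_, ?_⟩
    · intro s hs
      rw [mem_support_iff] at hs
      have h1 : ¬ Finsupp.single ⟨m, hm⟩ 1 ≤ s := fun h => hs (coeff_modMonomial_of_le _ h)
      rw [coeff_modMonomial_of_not_le _ h1] at hs
      have h2 := hp s (mem_support_iff.2 hs)
      rw [hcard, if_pos (by simpa using h1)] at h2
      simpa using h2
    · intro s hs
      rw [mem_support_iff, coeff_divMonomial] at hs
      have h2 := hp _ (mem_support_iff.2 hs)
      rw [hcard, hsame, if_neg (by simp)] at h2
      omega
    · rw [add_comm, divMonomial_add_modMonomial_single]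
  · rintro ⟨p1, p2, h1, h2, rfl⟩ s hs
    rcases Finset.mem_union.1 (support_add hs) with h | h
    · have := h1 s h
      rw [hcard]; omega
    · rw [support_X_mul, Finset.mem_map] at h
      obtain ⟨s', hs', rfl⟩ := h
      have := h2 s' hs'
      rw [addLeftEmbedding_apply, hcard, hsame, if_neg (by simp)]
      omega

theorem P_colon {m : ℕ} (hm : m < n) (t : ℕ) (p : MvPolynomial (Fin n) k)
    (h : P m t (X ⟨m, hm⟩ * p)) : P m t p := by
  intro s hs
  have h1 := h (Finsupp.single ⟨m, hm⟩ 1 + s) (by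
    rw [support_X_mul, Finset.mem_map]; exact ⟨s, hs, rfl⟩)
  refine h1.trans (Finset.card_le_card ?_)
  intro i
  simp only [Finset.mem_filter, Finsupp.mem_support_iff, Finsupp.add_apply]
  rintro ⟨h2, h3⟩
  rw [Finsupp.single_eq_of_ne (by rintro rfl; simp at h3), zero_add] at h2
  exact ⟨h2, h3⟩

theorem P_mono {m t : ℕ} {p : MvPolynomial (Fin n) k} (h : P m (t + 1) p) : P m t p :=
  fun s hs => (Nat.le_succ t).trans (h s hs)

theorem P_span (t : ℕ) (p : MvPolynomial (Fin n) k) :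
    p ∈ Ideal.span {p : MvPolynomial (Fin n) k |
        ∃ T : Finset (Fin n), T.card = t ∧
          p = MvPolynomial.monomial (∑ i ∈ T, Finsupp.single i 1) 1} ↔ P n t p := by
  have e : {p : MvPolynomial (Fin n) k |
        ∃ T : Finset (Fin n), T.card = t ∧
          p = MvPolynomial.monomial (∑ i ∈ T, Finsupp.single i 1) 1} =
      (fun s => monomial s (1 : k)) '' {s | ∃ T : Finset (Fin n), T.card = t ∧
        s = ∑ i ∈ T, Finsupp.single i 1} := by
    ext p
    constructor
    · rintro ⟨T, hT, rfl⟩; exact ⟨_, ⟨T, hT, rfl⟩, rfl⟩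
    · rintro ⟨_, ⟨T, hT, rfl⟩, rfl⟩; exact ⟨T, hT, rfl⟩
  rw [e, mem_ideal_span_monomial_image]
  have hv : ∀ (T : Finset (Fin n)) (j : Fin n),
      (∑ i ∈ T, Finsupp.single i 1 : Fin n →₀ ℕ) j = if j ∈ T then 1 else 0 := by
    intro T j
    simp [Finsupp.finsetSum_apply, Finsupp.single_apply]
  refine forall₂_congr fun s hs => ?_
  have e2 : (s.support.filter (fun i : Fin n => (i : ℕ) < n)) = s.support := by
    ext i; simp
  rw [e2]
  constructor
  · rintro ⟨_, ⟨T, hT, rfl⟩, h⟩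
    rw [← hT]
    refine Finset.card_le_card fun j hj => ?_
    have := h j
    rw [hv, if_pos hj] at this
    rw [Finsupp.mem_support_iff]; omega
  · intro h
    obtain ⟨T, hTs, hT⟩ := Finset.exists_subset_card_eq h
    refine ⟨_, ⟨T, hT, rfl⟩, fun j => ?_⟩
    rw [hv]
    split_ifs with hj
    · have := Finsupp.mem_support_iff.1 (hTs hj); omega
    · exact Nat.zero_le _

/-- Lifting a vector through homogeneous maps, keeping the degree. -/
theorem exists_hom_dot {ι : Type} [Fintype ι] (a v : ι → MvPolynomial (Fin n) k)
    (r m : ℕ) (ha : ∀ i, (a i).IsHomogeneous r) (hv : (a ⬝ᵥ v).IsHomogeneous (r + m)) :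
    ∃ w : ι → MvPolynomial (Fin n) k, (∀ i, (w i).IsHomogeneous m) ∧ a ⬝ᵥ w = a ⬝ᵥ v := by
  refine ⟨fun i => homogeneousComponent m (v i), fun i => homogeneousComponent_isHomogeneous _ _, ?_⟩
  rw [← hc_dot a v r m ha, homogeneousComponent_eq_self hv]

theorem exists_hom_mulVec {ι κ : Type} [Fintype ι] (A : Matrix κ ι (MvPolynomial (Fin n) k))
    (v : ι → MvPolynomial (Fin n) k)
    (r m : ℕ) (ha : ∀ i j, (A i j).IsHomogeneous r) (hv : ∀ j, ((A *ᵥ v) j).IsHomogeneous (r + m)) :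
    ∃ w : ι → MvPolynomial (Fin n) k, (∀ i, (w i).IsHomogeneous m) ∧ A *ᵥ w = A *ᵥ v := by
  refine ⟨fun i => homogeneousComponent m (v i), fun i => homogeneousComponent_isHomogeneous _ _, ?_⟩
  ext1 j
  change A j ⬝ᵥ _ = A j ⬝ᵥ v
  rw [← hc_dot (A j) v r m (ha j)]
  exact homogeneousComponent_eq_self (hv j)

namespace LinRes

theorem e_D {Q : MvPolynomial (Fin n) k → Prop} {t : ℕ} (L : LinRes k n Q t) (v) :
    L.e ⬝ᵥ (L.D 0 *ᵥ v) = 0 := (L.exact0 _).2 ⟨v, rfl⟩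

theorem D_D {Q : MvPolynomial (Fin n) k → Prop} {t : ℕ} (L : LinRes k n Q t) (q v) :
    L.D q *ᵥ (L.D (q + 1) *ᵥ v) = 0 := (L.exact q _).2 ⟨v, rfl⟩

end LinRes

/-- Linear comparison map between linear resolutions for an inclusion of ideals. -/
theorem exists_chain {Q R : MvPolynomial (Fin n) k → Prop} {t : ℕ} (J : LinRes k n Q (t + 1))
    (K : LinRes k n R t) (hQR : ∀ p, Q p → R p) :
    ∃ Φ : ∀ q, Matrix (K.ι q) (J.ι q) (MvPolynomial (Fin n) k),
      (∀ q i j, (Φ q i j).IsHomogeneous 1) ∧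
      (∀ v, K.e ⬝ᵥ (Φ 0 *ᵥ v) = J.e ⬝ᵥ v) ∧
      (∀ q v, K.D q *ᵥ (Φ (q + 1) *ᵥ v) = Φ q *ᵥ (J.D q *ᵥ v)) := by
  -- the good matrices at each level
  let T : ∀ q, Type _ := fun q => {A : Matrix (K.ι q) (J.ι q) (MvPolynomial (Fin n) k) //
    (∀ i j, (A i j).IsHomogeneous 1) ∧
      ∀ v, ∃ w, A *ᵥ (J.D q *ᵥ v) = K.D q *ᵥ w}
  have h0 : ∃ A : T 0, ∀ v, K.e ⬝ᵥ (A.1 *ᵥ v) = J.e ⬝ᵥ v := by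
    have : ∀ j, ∃ w : K.ι 0 → MvPolynomial (Fin n) k,
        (∀ i, (w i).IsHomogeneous 1) ∧ K.e ⬝ᵥ w = J.e j := by
      intro j
      obtain ⟨v, hv⟩ := (K.mem _).1 (hQR _ ((J.mem (J.e j)).2 ⟨Pi.single j 1, by simp⟩))
      obtain ⟨w, hw, h⟩ := exists_hom_dot K.e v t 1 K.e_hom (by rw [← hv]; exact J.e_hom j)
      exact ⟨w, hw, by rw [h, ← hv]⟩
    choose w hw h using this
    have hA : ∀ v, K.e ⬝ᵥ ((Matrix.of fun i j => w j i) *ᵥ v) = J.e ⬝ᵥ v := by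
      intro v
      rw [dotProduct_mulVec]
      congr 1
      ext1 j
      rw [← h j]; rfl
    refine ⟨⟨Matrix.of fun i j => w j i, fun i j => hw j i, fun v => ?_⟩, hA⟩
    rw [← K.exact0, hA, J.e_D]
  have hs : ∀ q (A : T q), ∃ B : T (q + 1), ∀ v, K.D q *ᵥ (B.1 *ᵥ v) = A.1 *ᵥ (J.D q *ᵥ v) := by
    intro q A
    have : ∀ j, ∃ w : K.ι (q + 1) → MvPolynomial (Fin n) k,
        (∀ i, (w i).IsHomogeneous 1) ∧ K.D q *ᵥ w = A.1 *ᵥ (J.D q *ᵥ (Pi.single j 1)) := by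
      intro j
      obtain ⟨v, hv⟩ := A.2.2 (Pi.single j 1)
      obtain ⟨w, hw, h⟩ := exists_hom_mulVec (K.D q) v 1 1 (K.D_hom q) (by
        intro i
        rw [← hv, mulVec_single_one]
        exact IsHomogeneous.sum _ _ _ fun l _ => (A.2.1 i l).mul (J.D_hom q l j))
      exact ⟨w, hw, by rw [h, ← hv]⟩
    choose w hw h using this
    have hA : ∀ v, K.D q *ᵥ ((Matrix.of fun i j => w j i) *ᵥ v) = A.1 *ᵥ (J.D q *ᵥ v) := by
      intro v
      rw [mulVec_mulVec, mulVec_mulVec]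
      congr 1
      ext1 i j
      have := congrFun (h j) i
      rw [mulVec_mulVec, mulVec_single_one] at this
      exact this
    refine ⟨⟨Matrix.of fun i j => w j i, fun i j => hw j i, fun v => ?_⟩, hA⟩
    rw [← K.exact, hA, J.D_D, mulVec_zero]
  obtain ⟨A0, hA0⟩ := h0
  choose nx hnx using hs
  let Φ : ∀ q, T q := fun q => Nat.rec A0 (fun q A => nx q A) q
  exact ⟨fun q => (Φ q).1, fun q => (Φ q).2.1, hA0, fun q v => hnx q (Φ q) v⟩

/-- shifted index types -/
def shι (ι : ℕ → Type) : ℕ → Type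
  | 0 => Empty
  | q + 1 => ι q

instance shFin (ι : ℕ → Type) [∀ q, Fintype (ι q)] : ∀ q, Fintype (shι ι q)
  | 0 => inferInstanceAs (Fintype Empty)
  | q + 1 => inferInstanceAs (Fintype (ι q))

instance shDec (ι : ℕ → Type) [∀ q, DecidableEq (ι q)] : ∀ q, DecidableEq (shι ι q)
  | 0 => inferInstanceAs (DecidableEq Empty)
  | q + 1 => inferInstanceAs (DecidableEq (ι q))

/-- shifted differential -/
def shD {R : Type*} (ι : ℕ → Type) (D : ∀ q, Matrix (ι q) (ι (q + 1)) R) :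
    ∀ q, Matrix (shι ι q) (ι q) R
  | 0 => fun i => Empty.elim i
  | q + 1 => D q

/-- The mapping cone. -/
noncomputable def coneD {Q R : MvPolynomial (Fin n) k → Prop} {t : ℕ} (J : LinRes k n Q (t + 1))
    (K : LinRes k n R t) (z : MvPolynomial (Fin n) k)
    (Φ : ∀ q, Matrix (K.ι q) (J.ι q) (MvPolynomial (Fin n) k)) (q : ℕ) :
    Matrix ((J.ι q ⊕ K.ι q) ⊕ shι J.ι q) ((J.ι (q + 1) ⊕ K.ι (q + 1)) ⊕ J.ι q)
      (MvPolynomial (Fin n) k) :=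
  fromBlocks (fromBlocks (J.D q) 0 0 (K.D q)) (fromRows (z • (1 : Matrix _ _ _)) (-Φ q)) 0
    (-shD J.ι J.D q)

theorem coneD_mulVec {Q R : MvPolynomial (Fin n) k → Prop} {t : ℕ} (J : LinRes k n Q (t + 1))
    (K : LinRes k n R t) (z : MvPolynomial (Fin n) k)
    (Φ : ∀ q, Matrix (K.ι q) (J.ι q) (MvPolynomial (Fin n) k)) (q : ℕ) (a b c) :
    coneD J K z Φ q *ᵥ (Sum.elim (Sum.elim a b) c) =
      Sum.elim (Sum.elim (J.D q *ᵥ a + z • c) (K.D q *ᵥ b - Φ q *ᵥ c)) (-(shD J.ι J.D q *ᵥ c)) := by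
  simp only [coneD, fromBlocks_mulVec, fromRows_mulVec]
  ext1 x
  rcases x with (x | x) | x
  · simp [smul_mulVec]
  · simp [neg_mulVec, sub_eq_add_neg]
  · simp [neg_mulVec]

theorem elim_inj {α β γ : Type*} {f f' : α → γ} {g g' : β → γ} :
    Sum.elim f g = Sum.elim f' g' ↔ f = f' ∧ g = g' := by
  constructor
  · intro h
    exact ⟨funext fun x => congrFun h (Sum.inl x), funext fun x => congrFun h (Sum.inr x)⟩
  · rintro ⟨rfl, rfl⟩; rfl

theorem elim_ex {α β γ : Type*} (v : α ⊕ β → γ) : ∃ f g, v = Sum.elim f g :=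
  ⟨v ∘ Sum.inl, v ∘ Sum.inr, by simp⟩

theorem cone_exact {Q R : MvPolynomial (Fin n) k → Prop} {t : ℕ} (J : LinRes k n Q (t + 1))
    (K : LinRes k n R t) (z : MvPolynomial (Fin n) k) (hz : z ≠ 0)
    (Φ : ∀ q, Matrix (K.ι q) (J.ι q) (MvPolynomial (Fin n) k))
    (hΦ : ∀ q v, K.D q *ᵥ (Φ (q + 1) *ᵥ v) = Φ q *ᵥ (J.D q *ᵥ v)) (q : ℕ) (v) :
    coneD J K z Φ q *ᵥ v = 0 ↔ ∃ w, v = coneD J K z Φ (q + 1) *ᵥ w := by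
  have hzero : ∀ {α β : Type}, (0 : α ⊕ β → MvPolynomial (Fin n) k) = Sum.elim (0 : α → MvPolynomial (Fin n) k) (0 : β → MvPolynomial (Fin n) k) := by
    intro α β; ext1 x; rcases x with x | x <;> rfl
  constructor
  · obtain ⟨u, c, rfl⟩ := elim_ex v
    obtain ⟨a, b, rfl⟩ := elim_ex u
    rw [coneD_mulVec, hzero, hzero, elim_inj, elim_inj]
    rintro ⟨⟨h1, h2⟩, h3⟩
    have hc : ∃ c', c = J.D q *ᵥ c' := by
      cases q with
      | zero =>
        rw [← J.exact0]
        have := congrArg (fun x => J.e ⬝ᵥ x) h1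
        simp only [dotProduct_add, J.e_D, dotProduct_smul, dotProduct_zero, zero_add, smul_eq_mul,
          mul_eq_zero, hz, false_or] at this
        exact this
      | succ q =>
        rw [← J.exact]
        exact neg_eq_zero.1 h3
    obtain ⟨c', rfl⟩ := hc
    obtain ⟨a', ha'⟩ := (J.exact q (a + z • c')).1 (by rw [mulVec_add, mulVec_smul]; exact h1)
    obtain ⟨b', hb'⟩ := (K.exact q (b - Φ (q + 1) *ᵥ c')).1 (by rw [mulVec_sub, hΦ]; exact h2)
    refine ⟨Sum.elim (Sum.elim a' b') (-c'), ?_⟩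
    refine Eq.trans ?_ (coneD_mulVec J K z Φ (q + 1) a' b' (-c')).symm
    rw [← ha', ← hb']
    refine elim_inj.2 ⟨elim_inj.2 ⟨?_, ?_⟩, ?_⟩
    · simp
    · simp [mulVec_neg]
    · change J.D q *ᵥ c' = -(J.D q *ᵥ (-c'))
      rw [mulVec_neg, neg_neg]
  · rintro ⟨w, rfl⟩
    obtain ⟨u, c, rfl⟩ := elim_ex w
    obtain ⟨a, b, rfl⟩ := elim_ex u
    have e1 : coneD J K z Φ (q + 1) *ᵥ (Sum.elim (Sum.elim a b) c) =
      Sum.elim (Sum.elim (J.D (q + 1) *ᵥ a + z • c) (K.D (q + 1) *ᵥ b - Φ (q + 1) *ᵥ c))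
        (-(J.D q *ᵥ c)) := coneD_mulVec J K z Φ (q + 1) a b c
    refine (congrArg (fun v => coneD J K z Φ q *ᵥ v) e1).trans ?_
    refine (coneD_mulVec J K z Φ q _ _ _).trans ?_
    rw [hzero, hzero, elim_inj, elim_inj]
    refine ⟨⟨?_, ?_⟩, ?_⟩
    · rw [mulVec_add, J.D_D, mulVec_smul]; simp
    · rw [mulVec_sub, K.D_D, mulVec_neg, hΦ]; simp
    · cases q with
      | zero => ext1 x; exact Empty.elim x
      | succ q =>
        change -(J.D q *ᵥ (-(J.D (q + 1) *ᵥ c))) = 0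
        rw [mulVec_neg, J.D_D]; simp

/-- The mapping cone as a linear resolution. -/
theorem cone_exists {m : ℕ} (hm : m < n) (t : ℕ) (J : LinRes k n (P m (t + 1)) (t + 1))
    (K : LinRes k n (P m t) t) :
    ∃ L : LinRes k n (P (m + 1) (t + 1)) (t + 1), ∀ q, Fintype.card (L.ι q) =
      Fintype.card (J.ι q) + Fintype.card (K.ι q) + Fintype.card (shι J.ι q) := by
  obtain ⟨Φ, hΦh, hΦ0, hΦ⟩ := exists_chain J K (fun p hp => P_mono hp)
  have hz : (X ⟨m, hm⟩ : MvPolynomial (Fin n) k) ≠ 0 := X_ne_zero _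
  have hzh : (X ⟨m, hm⟩ : MvPolynomial (Fin n) k).IsHomogeneous 1 := isHomogeneous_X _ _
  let e : (J.ι 0 ⊕ K.ι 0) ⊕ shι J.ι 0 → MvPolynomial (Fin n) k :=
    Sum.elim (Sum.elim J.e ((X ⟨m, hm⟩ : MvPolynomial (Fin n) k) • K.e)) (fun x => Empty.elim x)
  have he : ∀ a b c, e ⬝ᵥ (Sum.elim (Sum.elim a b) c) =
      J.e ⬝ᵥ a + X ⟨m, hm⟩ * (K.e ⬝ᵥ b) := by
    intro a b c
    have : (fun x : shι J.ι 0 => (Empty.elim x : MvPolynomial (Fin n) k)) = 0 := by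
      ext1 x; exact Empty.elim x
    simp only [e]
    rw [sumElim_dotProduct_sumElim, sumElim_dotProduct_sumElim, smul_dotProduct, this,
      zero_dotProduct, add_zero, smul_eq_mul]
  have hone : ∀ q (i j : J.ι q), ((X ⟨m, hm⟩ : MvPolynomial (Fin n) k) *
      (1 : Matrix (J.ι q) (J.ι q) (MvPolynomial (Fin n) k)) i j).IsHomogeneous 1 := by
    intro q i j
    rw [Matrix.one_apply]
    split_ifs
    · simpa using hzh
    · simpa using isHomogeneous_zero _ _ _
  refine ⟨{ ι := fun q => (J.ι q ⊕ K.ι q) ⊕ shι J.ι q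
            fin := fun q => inferInstance
            dec := fun q => inferInstance
            D := coneD J K (X ⟨m, hm⟩) Φ
            e := e
            e_hom := ?_
            D_hom := ?_
            mem := ?_
            exact0 := ?_
            exact := cone_exact J K _ hz Φ hΦ }, fun q => ?_⟩
  · rintro ((i | i) | i)
    · exact J.e_hom i
    · have h2 := hzh.mul (K.e_hom i)
      rw [add_comm 1 t] at h2
      exact h2
    · exact Empty.elim i
  · rintro q ((i | i) | i) ((j | j) | j)
    · exact J.D_hom q i j
    · exact isHomogeneous_zero _ _ _
    · exact hone q i j
    · exact isHomogeneous_zero _ _ _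
    · exact K.D_hom q i j
    · exact (hΦh q i j).neg
    · exact isHomogeneous_zero _ _ _
    · exact isHomogeneous_zero _ _ _
    · cases q with
      | zero => exact Empty.elim i
      | succ q => exact (J.D_hom q i j).neg
  · intro p
    rw [P_succ hm]
    constructor
    · rintro ⟨p1, p2, h1, h2, rfl⟩
      obtain ⟨a, rfl⟩ := (J.mem _).1 h1
      obtain ⟨b, rfl⟩ := (K.mem _).1 h2
      exact ⟨Sum.elim (Sum.elim a b) (fun x => Empty.elim x), (he _ _ _).symm⟩
    · rintro ⟨v, rfl⟩
      obtain ⟨u, c, rfl⟩ := elim_ex v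
      obtain ⟨a, b, rfl⟩ := elim_ex u
      exact ⟨_, _, (J.mem _).2 ⟨a, rfl⟩, (K.mem _).2 ⟨b, rfl⟩, he _ _ _⟩
  · intro v
    constructor
    · obtain ⟨u, c0, rfl⟩ := elim_ex v
      obtain ⟨a, b, rfl⟩ := elim_ex u
      rw [he]
      intro h
      have h1 : J.e ⬝ᵥ a = X ⟨m, hm⟩ * (-(K.e ⬝ᵥ b)) := by
        rw [mul_neg]; exact eq_neg_of_add_eq_zero_left h
      obtain ⟨c, hc⟩ := (J.mem _).1 (P_colon hm _ _ (by rw [← h1]; exact (J.mem _).2 ⟨a, rfl⟩))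
      rw [hc] at h1
      obtain ⟨a', ha'⟩ := (J.exact0 (a - (X ⟨m, hm⟩ : MvPolynomial (Fin n) k) • c)).1 (by
        rw [dotProduct_sub, dotProduct_smul, h1, smul_eq_mul, sub_self])
      obtain ⟨b', hb'⟩ := (K.exact0 (b + Φ 0 *ᵥ c)).1 (by
        rw [dotProduct_add, hΦ0, ← hc, add_neg_cancel])
      refine ⟨Sum.elim (Sum.elim a' b') c, ?_⟩
      erw [coneD_mulVec]
      rw [← ha', ← hb', elim_inj, elim_inj]
      refine ⟨⟨by simp, by simp⟩, ?_⟩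
      ext1 x; exact Empty.elim x
    · rintro ⟨w, rfl⟩
      obtain ⟨u, c', rfl⟩ := elim_ex w
      obtain ⟨a, b, rfl⟩ := elim_ex u
      obtain ⟨c, hc⟩ : ∃ c : J.ι 0 → MvPolynomial (Fin n) k, c = c' := ⟨c', rfl⟩
      subst hc
      have e1 := coneD_mulVec J K (X ⟨m, hm⟩) Φ 0 a b c
      refine (congrArg (fun v => e ⬝ᵥ v) e1).trans ?_
      rw [he, dotProduct_add, J.e_D, dotProduct_sub, K.e_D, hΦ0, dotProduct_smul, smul_eq_mul]
      ring
  · simp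

/-- the expected Betti numbers -/
def bet (m : ℕ) : ℕ → ℕ → ℕ
  | 0, q => if q = 0 then 1 else 0
  | t + 1, q => (t + q).choose t * m.choose (t + 1 + q)

theorem bet_zero (m t : ℕ) : bet (m + 1) (t + 1) 0 = bet m (t + 1) 0 + bet m t 0 := by
  cases t with
  | zero => simp [bet]
  | succ t => simp [bet, Nat.choose_succ_succ]; omega

theorem bet_succ (m t q : ℕ) : bet (m + 1) (t + 1) (q + 1) =
    bet m (t + 1) (q + 1) + bet m t (q + 1) + bet m (t + 1) q := by
  cases t with
  | zero =>
    simp only [bet]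
    rw [show 0 + 1 + (q + 1) = (q + 1) + 1 by ring, show 0 + 1 + q = q + 1 by ring,
      Nat.choose_succ_succ m (q + 1)]
    simp; ring
  | succ t =>
    simp only [bet]
    rw [show t + 1 + 1 + (q + 1) = (t + q + 2) + 1 by ring, Nat.choose_succ_succ m (t + q + 2),
      show t + 1 + (q + 1) = (t + q + 1) + 1 by ring, Nat.choose_succ_succ (t + q + 1) t,
      show t + 1 + 1 + q = t + q + 2 by ring, show t + (q + 1) = t + q + 1 by ring,
      show t + 1 + q = t + q + 1 by ring]
    simp only [Nat.succ_eq_add_one]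
    ring

theorem exists_linRes (k : Type*) [Field k] (n m : ℕ) (hm : m ≤ n) (t : ℕ) :
    ∃ L : LinRes k n (P m t) t, ∀ q, Fintype.card (L.ι q) = bet m t q := by
  have case0 : ∀ m, ∃ L : LinRes k n (P m 0) 0, ∀ q, Fintype.card (L.ι q) = bet m 0 q := by
    intro m
    refine ⟨{ ι := fun q => Fin (if q = 0 then 1 else 0)
              fin := fun q => inferInstance
              dec := fun q => inferInstance
              D := fun q => 0
              e := fun _ => 1
              e_hom := fun _ => isHomogeneous_one _ _
              D_hom := fun q i j => isHomogeneous_zero _ _ _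
              mem := ?_
              exact0 := ?_
              exact := ?_ }, fun q => by simp [bet]⟩
    · intro p
      refine ⟨fun _ => ⟨fun _ => p, ?_⟩, fun _ s _ => Nat.zero_le _⟩
      simp [dotProduct]
    · intro v
      constructor
      · intro h
        refine ⟨0, ?_⟩
        have hs : ∀ v : Fin 1 → MvPolynomial (Fin n) k, (fun _ => 1) ⬝ᵥ v = 0 → v = 0 := by
          intro v h
          ext1 i
          rw [Subsingleton.elim i 0]
          simpa [dotProduct] using h
        rw [mulVec_zero]
        exact hs v h
      · rintro ⟨w, rfl⟩; simp
    · intro q v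
      refine ⟨fun _ => ⟨0, ?_⟩, fun _ => ?_⟩
      · ext1 i; exact Fin.elim0 i
      · exact zero_mulVec _
  induction m generalizing t with
  | zero =>
    cases t with
    | zero => exact case0 0
    | succ t =>
      refine ⟨{ ι := fun q => Empty
                fin := fun q => inferInstance
                dec := fun q => inferInstance
                D := fun q => 0
                e := fun x => x.elim
                e_hom := fun x => x.elim
                D_hom := fun q i j => i.elim
                mem := ?_
                exact0 := fun v => ⟨fun _ => ⟨0, by ext1 x; exact x.elim⟩, fun _ => by simp⟩
                exact := fun q v => ⟨fun _ => ⟨0, by ext1 x; exact x.elim⟩,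
                  fun _ => by ext1 x; exact x.elim⟩ }, fun q => ?_⟩
      · intro p
        simp [P]
        constructor
        · intro h
          ext s
          exact h s
        · rintro rfl; simp
      · simp [bet, Nat.choose_eq_zero_of_lt]
  | succ m ih =>
    cases t with
    | zero => exact case0 _
    | succ t =>
      obtain ⟨J, hJ⟩ := ih (by omega) (t + 1)
      obtain ⟨K, hK⟩ := ih (by omega) t
      obtain ⟨L, hL⟩ := cone_exists (by omega) t J K
      refine ⟨L, fun q => ?_⟩
      rw [hL, hJ, hK]
      cases q with
      | zero => rw [bet_zero]; rfl
      | succ q => rw [bet_succ, ← hJ q]; rfl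

theorem main_aux {k : Type*} [Field k] (n t : ℕ) (I : Ideal (MvPolynomial (Fin n) k))
    (hI : ∀ p, p ∈ I ↔ P n t p)
    (F : MinimalFreeResolution (MvPolynomial (Fin n) k) (Ideal.span (Set.range MvPolynomial.X)) I)
    (q : ℕ) : F.β q = bet n t q := by
  obtain ⟨L, hL⟩ := exists_linRes k n n le_rfl t
  rw [← hL q]
  have hmem : ∀ p, p ∈ I ↔ ∃ v, p = L.e ⬝ᵥ v := fun p => (hI p).trans (L.mem p)
  let ε₀ : (L.ι 0 → MvPolynomial (Fin n) k) →ₗ[MvPolynomial (Fin n) k] MvPolynomial (Fin n) k :=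
    { toFun := fun v => L.e ⬝ᵥ v
      map_add' := fun v w => dotProduct_add _ _ _
      map_smul' := fun c v => dotProduct_smul _ _ _ }
  let ε : (L.ι 0 → MvPolynomial (Fin n) k) →ₗ[MvPolynomial (Fin n) k] I :=
    ε₀.codRestrict I (fun v => (hmem _).2 ⟨v, rfl⟩)
  have hεs : Function.Surjective ε := by
    rintro ⟨p, hp⟩
    obtain ⟨v, rfl⟩ := (hmem p).1 hp
    exact ⟨v, rfl⟩
  let d : ∀ q, (L.ι (q + 1) → MvPolynomial (Fin n) k) →ₗ[MvPolynomial (Fin n) k]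
    (L.ι q → MvPolynomial (Fin n) k) := fun q => (L.D q).mulVecLin
  have h0 : LinearMap.ker ε = LinearMap.range (d 0) := by
    ext v
    rw [LinearMap.mem_ker, LinearMap.mem_range]
    have : ε v = 0 ↔ L.e ⬝ᵥ v = 0 := by
      rw [← Subtype.val_inj]; rfl
    rw [this, L.exact0]
    exact exists_congr fun w => eq_comm
  have h1 : ∀ q, LinearMap.ker (d q) = LinearMap.range (d (q + 1)) := by
    intro q
    ext v
    rw [LinearMap.mem_ker, LinearMap.mem_range]
    exact (L.exact q v).trans (exists_congr fun w => eq_comm)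
  have hDm : ∀ q i j, L.D q i j ∈ Ideal.span (Set.range (MvPolynomial.X (σ := Fin n) (R := k))) := by
    intro q i j
    rw [← Set.image_univ, MvPolynomial.mem_ideal_span_X_image]
    intro s hs
    have h2 := (L.D_hom q i j) (MvPolynomial.mem_support_iff.1 hs)
    by_contra hcon
    push Not at hcon
    have : s = 0 := by
      ext i; exact hcon i (Set.mem_univ _)
    rw [this] at h2
    simp at h2
  have hm : ∀ q, LinearMap.range (d q) ≤ Ideal.span (Set.range (MvPolynomial.X (σ := Fin n) (R := k))) •
      (⊤ : Submodule (MvPolynomial (Fin n) k) (L.ι q → MvPolynomial (Fin n) k)) := by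
    rintro q _ ⟨v, rfl⟩
    rw [← Finset.univ_sum_single (d q v)]
    refine Submodule.sum_mem _ fun i _ => ?_
    have : Pi.single i (d q v i) = (d q v i) • (Pi.single i 1 : L.ι q → MvPolynomial (Fin n) k) := by
      rw [← Pi.single_smul, smul_eq_mul, mul_one]
    rw [this]
    refine Submodule.smul_mem_smul ?_ trivial
    exact Ideal.sum_mem _ fun j _ => Ideal.mul_mem_right _ _ (hDm q i j)
  have hπ : ∀ x ∈ Ideal.span (Set.range (MvPolynomial.X (σ := Fin n) (R := k))),
      MvPolynomial.constantCoeff x = 0 := by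
    intro x hx
    have : Ideal.span (Set.range (MvPolynomial.X (σ := Fin n) (R := k))) ≤
        RingHom.ker MvPolynomial.constantCoeff := by
      rw [Ideal.span_le]
      rintro _ ⟨i, rfl⟩
      simp
    exact this hx
  apply le_antisymm
  · obtain ⟨f, g, -, -, -, -, h⟩ := compare (fun q => Fin (F.β q) →₀ MvPolynomial (Fin n) k)
      (fun q => L.ι q → MvPolynomial (Fin n) k) F.d d F.ε ε F.surj hεs F.exact_zero h0 F.exact h1
      F.minimal q
    have := card_le MvPolynomial.constantCoeff hπ Finsupp.basisSingleOne (Pi.basisFun _ _) f g h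
    simpa using this
  · obtain ⟨f, g, -, -, -, -, h⟩ := compare (fun q => L.ι q → MvPolynomial (Fin n) k)
      (fun q => Fin (F.β q) →₀ MvPolynomial (Fin n) k) d F.d ε F.ε hεs F.surj h0 F.exact_zero h1
      F.exact hm q
    have := card_le MvPolynomial.constantCoeff hπ (Pi.basisFun _ _) Finsupp.basisSingleOne f g h
    simpa using this

end SqVer

/-- The Betti numbers of the squarefree Veronese ideal (the case `b_1 = ⋯ = b_n = 1` of
Proposition 2.4): if `I` is the ideal of `k[z_1,…,z_n]` generated by all squarefree
monomials of degree `t`, then `β_q(I) = C(t+q−1, t−1) · C(n, t+q)`. -/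
theorem betti_squarefree_veronese {k : Type*} [Field k] (n t : ℕ) (ht : 1 ≤ t) (htn : t ≤ n)
    (F : MinimalFreeResolution (MvPolynomial (Fin n) k)
      (Ideal.span (Set.range MvPolynomial.X))
      (Ideal.span {p : MvPolynomial (Fin n) k |
        ∃ T : Finset (Fin n), T.card = t ∧
          p = MvPolynomial.monomial (∑ i ∈ T, Finsupp.single i 1) 1}))
    (q : ℕ) :
    F.β q = (t + q - 1).choose (t - 1) * n.choose (t + q) := by
  rw [SqVer.main_aux n t _ (fun p => SqVer.P_span t p) F q]
  obtain ⟨s, rfl⟩ : ∃ s, t = s + 1 := ⟨t - 1, by omega⟩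
  simp only [SqVer.bet]
  congr 2
  omega
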